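/- Let Λ = ℤ^{n₊} with positive definite integer quadratic form Q(k) = kᵀ Q k (Q symmetric positive definite), let m_1, …, m_{n₋} ∈ Λ*, m_0 ∈ ℚ^{n₋}, R ∈ ℚ, and let τ ∈ ℂ with Im(τ) > 0, q = e^{2πiτ}. Define the generalized Appell function A_{Q,{m_i}}(u, v, τ) = e^{2πi m_0·u} ∑_{k ∈ Λ} q^{Q(k)/2 + R} e^{2πi v·k} / ∏_{j=1}^{n₋} (1 − q^{m_j·k} e^{2πi u_j}) for u ∈ ℂ^{n₋}, v ∈ ℂ^{n₊} with all denominators nonzero, and the theta function Θ_Q(v, τ) = ∑_{k ∈ Λ} q^{Q(k)/2 + R} e^{2πi v·k}. Let z = (z_1, …, z_{n₋}) ∈ ℂ^{n₋} with 0 < Im(z_j) < Im(τ) suitably so that all series below converge. Then ∑_{l ∈ ℤ^{n₋}} A_{Q,{m_i}}(u + lτ, v, τ) e^{2πi l·(z − m_0 τ) − 2πi m_0·u} = Θ_Q(v − Mz, τ) ∏_{j=1}^{n₋} ( η(τ)³ θ₁(u_j + z_j, τ) / (i θ₁(u_j, τ) θ₁(z_j, τ)) ), where M is the matrix with rows m_jᵀ,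 i.e., (Mz)_i = ∑_j (m_j)_i z_j. -/

import Mathlib

open Complex

/-- The Dedekind eta function `η(τ) = q^{1/24} ∏_{n ≥ 1} (1 − qⁿ)`, `q = e^{2πiτ}`. -/
noncomputable def dedekindEta (τ : ℂ) : ℂ :=
  Complex.exp (Real.pi * I * τ / 12) *
    ∏' n : ℕ, (1 - Complex.exp (2 * Real.pi * I * τ * (n + 1)))

/-- The Jacobi theta function
`θ₁(z,τ) = i ∑_{r ∈ ℤ+1/2} (−1)^{r−1/2} q^{r²/2} e^{2πirz}`. -/
noncomputable def jacobiTheta1 (z τ : ℂ) : ℂ :=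
  I * ∑' n : ℤ, (-1 : ℂ) ^ n * Complex.exp (Real.pi * I * τ * (n + 1 / 2) ^ 2) *
    Complex.exp (2 * Real.pi * I * (n + 1 / 2) * z)

/-- A single term `q^{Q(k)/2 + R} e^{2πi v·k} / ∏_j (1 − q^{m_j·k} e^{2πi u_j})` of the
generalized Appell function with signature `(n₊, n₋)`. -/
noncomputable def genAppellTerm (np nm : ℕ) (Q : Matrix (Fin np) (Fin np) ℤ) (R : ℚ)
    (m : Fin nm → Fin np → ℤ) (u : Fin nm → ℂ) (v : Fin np → ℂ) (τ : ℂ)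
    (k : Fin np → ℤ) : ℂ :=
  Complex.exp (Real.pi * I * τ * (((∑ i, ∑ j, k i * Q i j * k j : ℤ) : ℂ) + 2 * (R : ℂ))) *
    Complex.exp (2 * Real.pi * I * ∑ i, v i * (k i : ℂ)) /
      ∏ j, (1 - Complex.exp (2 * Real.pi * I * τ * (∑ i, (m j i : ℂ) * (k i : ℂ))) *
        Complex.exp (2 * Real.pi * I * u j))

/-- The generalized Appell function
`A_{Q,{m_i}}(u,v,τ) = e^{2πi m₀·u} ∑_{k ∈ Λ} q^{Q(k)/2 + R} e^{2πi v·k} / ∏_j (1 − q^{m_j·k} e^{2πi u_j})`. -/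
noncomputable def genAppell (np nm : ℕ) (Q : Matrix (Fin np) (Fin np) ℤ) (R : ℚ)
    (m : Fin nm → Fin np → ℤ) (m0 : Fin nm → ℚ) (u : Fin nm → ℂ) (v : Fin np → ℂ)
    (τ : ℂ) : ℂ :=
  Complex.exp (2 * Real.pi * I * ∑ j, (m0 j : ℂ) * u j) *
    ∑' k : Fin np → ℤ, genAppellTerm np nm Q R m u v τ k

/-- The theta function `Θ_Q(v,τ) = ∑_{k ∈ Λ} q^{Q(k)/2 + R} e^{2πi v·k}`. -/
noncomputable def genTheta (np : ℕ) (Q : Matrix (Fin np) (Fin np) ℤ) (R : ℚ)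
    (v : Fin np → ℂ) (τ : ℂ) : ℂ :=
  ∑' k : Fin np → ℤ,
    Complex.exp (Real.pi * I * τ * (((∑ i, ∑ j, k i * Q i j * k j : ℤ) : ℂ) + 2 * (R : ℂ))) *
      Complex.exp (2 * Real.pi * I * ∑ i, v i * (k i : ℂ))

/-! ### Auxiliary exponentials and theta function -/

/-- `ee x = e^{2πix}`. -/
noncomputable def ee (x : ℂ) : ℂ := Complex.exp (2 * Real.pi * I * x)

lemma ee_add (x y : ℂ) : ee (x + y) = ee x * ee y := by
  rw [ee, ee, ee, ← Complex.exp_add, mul_add]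

lemma ee_zero : ee 0 = 1 := by simp [ee]

lemma ee_ne_zero (x : ℂ) : ee x ≠ 0 := Complex.exp_ne_zero _

lemma norm_ee (x : ℂ) : ‖ee x‖ = Real.exp (-2 * Real.pi * x.im) := by
  rw [ee, Complex.norm_exp]
  congr 1
  simp

lemma ee_neg (x : ℂ) : ee (-x) = (ee x)⁻¹ := by
  rw [ee, ee, ← Complex.exp_neg]; congr 1; ring

lemma ee_sum {ι : Type*} (s : Finset ι) (f : ι → ℂ) : ee (∑ i ∈ s, f i) = ∏ i ∈ s, ee (f i) := by
  rw [ee, Finset.mul_sum, Complex.exp_sum]; rfl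

lemma ee_half_int (k : ℤ) : ee ((k + 1 : ℤ) / 2) = - ee ((k : ℤ) / 2) := by
  have : ((k + 1 : ℤ) : ℂ) / 2 = (k : ℂ) / 2 + 1 / 2 := by push_cast; ring
  rw [this, ee_add]
  have : ee (1 / 2) = -1 := by
    rw [ee, ← Complex.exp_pi_mul_I]; congr 1; ring
  rw [this]; ring

lemma ee_int (k : ℤ) : ee k = 1 := by
  rw [ee, mul_comm]; exact Complex.exp_int_mul_two_pi_mul_I k

/-- theta coefficients `(-1)^k q^{k(k+1)/2}` -/
noncomputable def bb (τ : ℂ) (k : ℤ) : ℂ := ee ((k : ℂ) / 2 + τ * (k * (k + 1)) / 2)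

/-- `∑ (-1)^k q^{k(k+1)/2} e^{2πi k u}` -/
noncomputable def Th (τ u : ℂ) : ℂ := ∑' k : ℤ, bb τ k * ee (k * u)

lemma bb_mul_ee (τ u : ℂ) (k : ℤ) :
    bb τ k * ee (k * u) = jacobiTheta₂_term k (u + (1 / 2 + τ / 2)) τ := by
  rw [bb, ← ee_add, ee, jacobiTheta₂_term]
  congr 1; ring

lemma bb_eq (τ : ℂ) (k : ℤ) : bb τ k = bb τ k * ee (k * 0) := by
  rw [mul_zero, ee_zero, mul_one]

lemma Th_eq (τ u : ℂ) : Th τ u = jacobiTheta₂ (u + (1 / 2 + τ / 2)) τ := by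
  rw [Th, jacobiTheta₂]; exact tsum_congr fun k => bb_mul_ee τ u k

lemma summable_bb_ee {τ : ℂ} (hτ : 0 < τ.im) (u : ℂ) :
    Summable fun k : ℤ => ‖bb τ k * ee (k * u)‖ := by
  simp_rw [bb_mul_ee]
  exact ((summable_jacobiTheta₂_term_iff _ τ).mpr hτ).norm

lemma summable_bb {τ : ℂ} (hτ : 0 < τ.im) : Summable fun k : ℤ => ‖bb τ k‖ := by
  have := summable_bb_ee hτ 0
  simpa only [← bb_eq] using this

lemma bb_succ (τ : ℂ) (k : ℤ) : bb τ (k + 1) = - ee ((k + 1) * τ) * bb τ k := by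
  have h : τ * (((k + 1 : ℤ) : ℂ) * ((k + 1 : ℤ) + 1)) / 2
      = (k + 1) * τ + τ * (k * (k + 1)) / 2 := by push_cast; ring
  rw [bb, bb, ee_add, ee_half_int, h, ee_add, ee_add]
  ring

lemma hasDerivAt_Th {τ : ℂ} (hτ : 0 < τ.im) :
    HasDerivAt (Th τ) (2 * Real.pi * I * ∑' k : ℤ, k * bb τ k) 0 := by
  have h := (hasDerivAt_jacobiTheta₂_fst (0 + (1 / 2 + τ / 2)) hτ).comp_add_const 0 (1 / 2 + τ / 2)
  have h1 : (fun u => jacobiTheta₂ (u + (1 / 2 + τ / 2)) τ) = Th τ := by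
    funext u; rw [Th_eq]
  have h2 : jacobiTheta₂' (0 + (1 / 2 + τ / 2)) τ = 2 * Real.pi * I * ∑' k : ℤ, k * bb τ k := by
    rw [jacobiTheta₂', ← tsum_mul_left]
    refine tsum_congr fun k => ?_
    rw [jacobiTheta₂'_term, ← bb_mul_ee, mul_zero, ee_zero]; ring
  rwa [h1, h2] at h

lemma continuous_Th {τ : ℂ} (hτ : 0 < τ.im) : Continuous (Th τ) := by
  have h1 : Th τ = (fun u => jacobiTheta₂ (u + (1 / 2 + τ / 2)) τ) := by
    funext u; rw [Th_eq]
  rw [h1, continuous_iff_continuousAt]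
  intro u
  exact ((hasDerivAt_jacobiTheta₂_fst (u + (1 / 2 + τ / 2)) hτ).comp_add_const u _).continuousAt

lemma tsum_eq_zero_of_odd (f : ℤ → ℂ) (c : ℤ) (h : ∀ k, f (c - k) = - f k) :
    ∑' k, f k = 0 := by
  have h1 : ∑' k, f k = ∑' k, f (c - k) := ((Equiv.subLeft c).tsum_eq f).symm
  simp_rw [h, tsum_neg] at h1
  exact self_eq_neg.mp h1

lemma bb_neg (τ : ℂ) (k : ℤ) : bb τ (-1 - k) = - bb τ k := by
  have : (((-1 - k : ℤ) : ℂ) / 2 + τ * ((-1 - k : ℤ) * ((-1 - k : ℤ) + 1)) / 2)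
      = ((-k-1 : ℤ) : ℂ) + (((k + 1 : ℤ) : ℂ) / 2 + τ * (k * (k + 1)) / 2) := by
    push_cast; ring
  rw [bb, this, ee_add, ee_int, one_mul, ee_add, ee_half_int, bb, ee_add, neg_mul]

lemma Th_zero (τ : ℂ) : Th τ 0 = 0 := by
  rw [Th]
  apply tsum_eq_zero_of_odd _ (-1)
  intro k
  simp only [mul_zero, ee_zero, mul_one]
  exact bb_neg τ k

lemma Th_tau (τ : ℂ) : Th τ τ = 0 := by
  have : ∀ k : ℤ, bb τ k * ee (k * τ) = - ee (-τ) * bb τ (k + 1) := by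
    intro k
    rw [bb_succ, add_mul, ee_add, one_mul, ee_neg]
    field_simp [ee_ne_zero]
  rw [Th, tsum_congr this, tsum_mul_left]
  have h := (Equiv.addRight (1 : ℤ)).tsum_eq (bb τ)
  simp only [Equiv.coe_addRight] at h
  rw [h]
  rw [tsum_eq_zero_of_odd (bb τ) (-1) (bb_neg τ), mul_zero]

lemma theta1_eq (z τ : ℂ) : jacobiTheta1 z τ = I * ee (τ / 8) * ee (z / 2) * Th τ z := by
  rw [jacobiTheta1, Th, mul_assoc I (ee _), mul_assoc I]
  congr 1
  rw [← tsum_mul_left]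
  refine tsum_congr fun k => ?_
  have : (-1 : ℂ) ^ k = ee (k / 2) := by
    rw [← Complex.exp_pi_mul_I, ← Complex.exp_int_mul, ee]
    congr 1; ring
  rw [this, bb, ← ee_add, ← ee_add, ← ee_add]
  simp only [ee]
  rw [← Complex.exp_add, ← Complex.exp_add]
  congr 1; ring

/-! ### The Kronecker identity -/

/-- denominators `1 - e^{2πiu} q^n`. -/
noncomputable def DD (τ u : ℂ) (n : ℤ) : ℂ := 1 - ee (u + n * τ)

lemma DD_neg (τ u : ℂ) (n : ℤ) : DD τ u n = - ee (u + n * τ) * DD τ (-u) (-n) := by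
  have : -u + ((-n : ℤ) : ℂ) * τ = -(u + n * τ) := by push_cast; ring
  rw [DD, DD, this, ee_neg]
  field_simp [ee_ne_zero]
  ring

lemma tendsto_norm_ee_top {τ : ℂ} (hτ : 0 < τ.im) (u : ℂ) :
    Filter.Tendsto (fun n : ℤ => ‖ee (u + n * τ)‖) Filter.atTop (nhds 0) := by
  simp_rw [norm_ee]
  apply Real.tendsto_exp_atBot.comp
  have h1 : ∀ n : ℤ, -2 * Real.pi * (u + n * τ).im
      = -2 * Real.pi * u.im + (-2 * Real.pi * τ.im) * n := by
    intro n; simp; ring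
  simp_rw [h1]
  apply Filter.tendsto_atBot_add_const_left
  apply Filter.Tendsto.const_mul_atTop_of_neg
  · have := Real.pi_pos; nlinarith [mul_pos this hτ]
  · exact tendsto_intCast_atTop_atTop

lemma tendsto_norm_ee_bot {τ : ℂ} (hτ : 0 < τ.im) (u : ℂ) :
    Filter.Tendsto (fun n : ℤ => ‖ee (u + n * τ)‖) Filter.atBot Filter.atTop := by
  simp_rw [norm_ee]
  apply Real.tendsto_exp_atTop.comp
  have h1 : ∀ n : ℤ, -2 * Real.pi * (u + n * τ).im
      = -2 * Real.pi * u.im + (-2 * Real.pi * τ.im) * n := by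
    intro n; simp; ring
  simp_rw [h1]
  apply Filter.tendsto_atTop_add_const_left
  apply Filter.Tendsto.const_mul_atBot_of_neg
  · have := Real.pi_pos; nlinarith [mul_pos this hτ]
  · exact tendsto_intCast_atBot_iff.mpr Filter.tendsto_id

lemma DD_bound {τ : ℂ} (hτ : 0 < τ.im) (u : ℂ) :
    ∃ C : ℝ, 0 ≤ C ∧ ∀ n, ‖(DD τ u n)⁻¹‖ ≤ C := by
  have hO : (fun n => (DD τ u n)⁻¹) =O[Filter.cofinite] (fun _ => (1 : ℝ)) := by
    rw [Int.cofinite_eq]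
    refine Asymptotics.IsBigO.of_bound 2 ?_
    rw [Filter.eventually_sup]
    have key : ∀ n, (1 : ℝ) / 2 ≤ ‖DD τ u n‖ → ‖(DD τ u n)⁻¹‖ ≤ 2 * ‖(1 : ℝ)‖ := by
      intro n hn
      rw [norm_inv, norm_one, mul_one]
      exact inv_le_of_inv_le₀ (by norm_num) (by linarith)
    constructor
    · filter_upwards [(tendsto_norm_ee_bot hτ u).eventually_ge_atTop 2] with n hn
      apply key
      have := norm_sub_norm_le (ee (u + n * τ)) 1
      rw [norm_sub_rev, norm_one] at this
      rw [DD]; linarith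
    · filter_upwards [(tendsto_norm_ee_top hτ u).eventually_le_const (show (0:ℝ) < 1/2 by norm_num)]
        with n hn
      apply key
      have := norm_sub_norm_le 1 (ee (u + n * τ))
      rw [norm_one] at this
      rw [DD]; linarith
  obtain ⟨C, hC⟩ := (Asymptotics.isBigO_cofinite_iff (by simp)).mp hO
  refine ⟨max C 0, le_max_right _ _, fun n => (hC n).trans ?_⟩
  simp

/-- regularised coefficient -/
noncomputable def rr (τ u : ℂ) (n : ℤ) : ℂ := (DD τ u n)⁻¹ - if 0 ≤ n then 1 else 0

lemma rr_bound {τ : ℂ} (hτ : 0 < τ.im) (u : ℂ) (hu : ∀ n, DD τ u n ≠ 0) :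
    ∃ C : ℝ, 0 ≤ C ∧ ∀ n : ℤ, ‖rr τ u n‖ ≤ C * Real.exp (-2 * Real.pi * τ.im * |(n : ℝ)|) := by
  obtain ⟨C, hC0, hC⟩ := DD_bound hτ u
  obtain ⟨C', hC0', hC'⟩ := DD_bound hτ (-u)
  refine ⟨max (‖ee u‖ * C) (‖ee (-u)‖ * C'), by positivity, fun n => ?_⟩
  rw [rr]
  split_ifs with hn
  · have : (DD τ u n)⁻¹ - 1 = ee u * (DD τ u n)⁻¹ * ee (n * τ) := by
      have h := hu n
      have h2 : ee u * ee (n * τ) = 1 - DD τ u n := by rw [DD, ee_add]; ring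
      field_simp
      rw [h2]
    rw [this, norm_mul, norm_mul, norm_ee (n * τ)]
    have hn' : |(n : ℝ)| = n := abs_of_nonneg (by exact_mod_cast hn)
    rw [hn']
    have h3 : -2 * Real.pi * (n * τ).im = -2 * Real.pi * τ.im * n := by simp; ring
    rw [h3]
    gcongr
    exact le_trans (by gcongr; exact hC n) (le_max_left _ _)
  · have : (DD τ u n)⁻¹ - 0 = -ee (-u) * (DD τ (-u) (-n))⁻¹ * ee (-(n * τ)) := by
      rw [DD_neg τ u n, sub_zero, mul_inv, inv_neg, ← ee_neg, neg_add, ee_add]; ring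
    rw [this, norm_mul, norm_mul, norm_neg, norm_ee (-(n * τ))]
    have hn' : |(n : ℝ)| = -n := abs_of_nonpos (by exact_mod_cast (by omega))
    rw [hn']
    have h3 : -2 * Real.pi * (-(n * τ)).im = -2 * Real.pi * τ.im * -n := by simp; ring
    rw [h3]
    gcongr
    exact le_trans (by gcongr; exact hC' (-n)) (le_max_right _ _)

lemma summable_exp_abs {a : ℝ} (ha : 0 < a) :
    Summable fun n : ℤ => Real.exp (-2 * Real.pi * a * |(n : ℝ)|) := by
  have h : Summable fun n : ℕ => Real.exp (-2 * Real.pi * a * n) := by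
    have h1 : Real.exp (-2 * Real.pi * a) < 1 := by
      rw [Real.exp_lt_one_iff]
      have := mul_pos Real.pi_pos ha; nlinarith
    refine (summable_geometric_of_lt_one (Real.exp_pos _).le h1).congr fun n => ?_
    rw [← Real.exp_nat_mul]; congr 1; ring
  apply Summable.of_nat_of_neg <;> simpa using h

lemma rr_ee_bound {τ : ℂ} (u : ℂ) {C : ℝ} (hC0 : 0 ≤ C)
    (hC : ∀ n : ℤ, ‖rr τ u n‖ ≤ C * Real.exp (-2 * Real.pi * τ.im * |(n : ℝ)|))
    {z : ℂ} {a : ℝ} (hz : 0 < z.im) (hza : z.im + a ≤ τ.im) (n : ℤ) :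
    ‖ee (n * z) * rr τ u n‖ ≤ C * Real.exp (-2 * Real.pi * a * |(n : ℝ)|) := by
  rw [norm_mul, norm_ee]
  calc _ ≤ Real.exp (-2 * Real.pi * (n * z).im) *
        (C * Real.exp (-2 * Real.pi * τ.im * |(n : ℝ)|)) := by gcongr; exact hC n
    _ = C * Real.exp (-2 * Real.pi * (n * z).im + -2 * Real.pi * τ.im * |(n : ℝ)|) := by
        rw [Real.exp_add]; ring
    _ ≤ _ := by
        gcongr
        have h1 : (n * z).im = n * z.im := by simp
        rw [h1]
        have h2 := neg_abs_le (n : ℝ)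
        have h3 := abs_nonneg (n : ℝ)
        have : 0 ≤ n * z.im + τ.im * |(n : ℝ)| - a * |(n : ℝ)| := by nlinarith
        have := mul_nonneg Real.pi_pos.le this
        nlinarith

lemma summable_pos_ee {z : ℂ} (hz : 0 < z.im) :
    Summable fun n : ℤ => ‖ee (n * z) * if 0 ≤ n then 1 else 0‖ := by
  refine (summable_exp_abs hz).of_nonneg_of_le (fun _ => norm_nonneg _) fun n => ?_
  rw [norm_mul]
  split_ifs with hn
  · rw [norm_one, mul_one, norm_ee]
    have hn' : |(n : ℝ)| = n := abs_of_nonneg (by exact_mod_cast hn)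
    rw [hn']; apply le_of_eq; congr 1; simp; ring
  · rw [norm_zero, mul_zero]; positivity

lemma tsum_pos_ee {z : ℂ} (hz : 0 < z.im) :
    ∑' n : ℤ, (ee (n * z) * if 0 ≤ n then 1 else 0) = (1 - ee z)⁻¹ := by
  have hlt : ‖ee z‖ < 1 := by
    rw [norm_ee, Real.exp_lt_one_iff]
    have := mul_pos Real.pi_pos hz; nlinarith
  rw [← tsum_geometric_of_norm_lt_one hlt]
  have h := (Nat.cast_injective (R := ℤ)).tsum_eq
    (f := fun n : ℤ => (ee (n * z) * if 0 ≤ n then 1 else 0)) (by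
      intro n hn
      simp only [Function.mem_support, ne_eq, mul_eq_zero, not_or] at hn
      have : 0 ≤ n := by by_contra hc; simp [hc] at hn
      exact ⟨n.toNat, by simp [this]⟩)
  rw [← h]
  refine tsum_congr fun n => ?_
  simp only [Int.cast_natCast, Nat.cast_nonneg, if_true, mul_one]
  rw [ee, ee, ← Complex.exp_nat_mul]; congr 1; ring

lemma ee_div_DD (τ u z : ℂ) (n : ℤ) : ee (n * z) * (DD τ u n)⁻¹ =
    ee (n * z) * rr τ u n + ee (n * z) * if 0 ≤ n then 1 else 0 := by
  rw [rr]; ring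

lemma summable_rr {τ u z : ℂ} (hτ : 0 < τ.im) (hu : ∀ n, DD τ u n ≠ 0)
    (hz : 0 < z.im) (hz' : z.im < τ.im) :
    Summable fun n : ℤ => ‖ee (n * z) * rr τ u n‖ := by
  obtain ⟨C, hC0, hC⟩ := rr_bound hτ u hu
  exact ((summable_exp_abs (a := τ.im - z.im) (by linarith)).mul_left C).of_nonneg_of_le
    (fun _ => norm_nonneg _) fun n => rr_ee_bound u hC0 hC hz (by linarith) n

lemma summable_kron {τ u z : ℂ} (hτ : 0 < τ.im) (hu : ∀ n, DD τ u n ≠ 0)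
    (hz : 0 < z.im) (hz' : z.im < τ.im) :
    Summable fun n : ℤ => ‖ee (n * z) * (DD τ u n)⁻¹‖ := by
  refine ((summable_rr hτ hu hz hz').add (summable_pos_ee hz)).of_nonneg_of_le
    (fun _ => norm_nonneg _) fun n => ?_
  rw [ee_div_DD]; exact norm_add_le _ _

/-- the single-variable Kronecker sum -/
noncomputable def SS (τ u z : ℂ) : ℂ := ∑' n : ℤ, ee (n * z) * (DD τ u n)⁻¹

/-- `∑_n b(N-n)/(1-x q^n)` -/
noncomputable def ff (τ u : ℂ) (N : ℤ) : ℂ := ∑' n : ℤ, bb τ (N - n) * (DD τ u n)⁻¹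

lemma summable_ff {τ : ℂ} (hτ : 0 < τ.im) (u : ℂ) (N : ℤ) :
    Summable fun n : ℤ => bb τ (N - n) * (DD τ u n)⁻¹ := by
  obtain ⟨C, hC0, hC⟩ := DD_bound hτ u
  have h := ((Equiv.subLeft N).summable_iff.mpr (summable_bb hτ)).mul_right C
  refine Summable.of_norm_bounded h fun n => ?_
  rw [norm_mul]
  exact mul_le_mul_of_nonneg_left (hC n) (norm_nonneg _)

lemma ff_succ {τ : ℂ} (hτ : 0 < τ.im) (u : ℂ) (hu : ∀ n, DD τ u n ≠ 0) (N : ℤ) :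
    ff τ u (N + 1) = - ee ((N + 1) * τ) * ee u * ff τ u N := by
  have h0 : ∀ n : ℤ, bb τ (N + 1 - n) * (DD τ u n)⁻¹
      = - ee ((N + 1) * τ) * ee u * (bb τ (N - n) * (DD τ u n)⁻¹)
        + (- ee τ) * (bb τ (N - n) * ee ((N - n : ℤ) * τ)) := by
    intro n
    have h1 : bb τ (N + 1 - n) = - ee ((N + 1 - n) * τ) * bb τ (N - n) := by
      have := bb_succ τ (N - n)
      rw [show N - n + 1 = N + 1 - n by ring] at this
      rw [this]; congr 3; push_cast; ring
    have h2 : ee (u + n * τ) = 1 - DD τ u n := by rw [DD]; ring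
    have h3 : ee ((N + 1) * τ) * ee u = ee ((N + 1 - n) * τ) * ee (u + n * τ) := by
      rw [← ee_add, ← ee_add]; congr 1; ring
    have h4 : ee ((N + 1 - n) * τ) = ee τ * ee ((N - n : ℤ) * τ) := by
      rw [← ee_add]; congr 1; push_cast; ring
    rw [h1, neg_mul (ee ((N + 1) * τ)), h3, h2, h4]
    have := hu n
    field_simp
    ring
  rw [ff, tsum_congr h0, Summable.tsum_add ((summable_ff hτ u N).mul_left _), tsum_mul_left,
    tsum_mul_left]
  · have h5 := (Equiv.subLeft N).tsum_eq (fun k : ℤ => bb τ k * ee (k * τ))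
    simp only [Equiv.subLeft_apply] at h5
    rw [h5]
    have := Th_tau τ
    rw [Th] at this
    rw [this, mul_zero, add_zero, ff]
  · exact ((Equiv.subLeft N).summable_iff.mpr (summable_bb_ee hτ τ).of_norm).mul_left _

lemma ff_eq {τ : ℂ} (hτ : 0 < τ.im) (u : ℂ) (hu : ∀ n, DD τ u n ≠ 0) (N : ℤ) :
    ff τ u N = bb τ N * ee (N * u) * ff τ u 0 := by
  have hs : ∀ N : ℤ, bb τ (N + 1) * ee ((N + 1 : ℤ) * u)
      = - ee ((N + 1) * τ) * ee u * (bb τ N * ee (N * u)) := by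
    intro N
    rw [bb_succ]; push_cast; rw [add_mul, add_mul, ee_add (N * u), one_mul, one_mul]; ring
  induction N using Int.induction_on with
  | zero => simp [bb, ee_zero]
  | succ n ih => rw [ff_succ hτ u hu, ih, hs]; ring
  | pred n ih =>
    have h1 := ff_succ hτ u hu (-n - 1)
    have h2 := hs (-n - 1)
    rw [sub_add_cancel] at h1 h2
    rw [h1, h2] at ih
    have hne : - ee (((-n - 1 : ℤ) + 1) * τ) * ee u ≠ 0 :=
      mul_ne_zero (neg_ne_zero.mpr (ee_ne_zero _)) (ee_ne_zero _)
    apply mul_left_cancel₀ hne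
    rw [ih]; ring

lemma Th_mul_SS {τ u z : ℂ} (hτ : 0 < τ.im) (hu : ∀ n, DD τ u n ≠ 0)
    (hz : 0 < z.im) (hz' : z.im < τ.im) :
    Th τ z * SS τ u z = ff τ u 0 * Th τ (u + z) := by
  have hs1 := summable_bb_ee hτ z
  have hs2 := summable_kron hτ hu hz hz'
  rw [Th, SS, tsum_mul_tsum_of_summable_norm hs1 hs2]
  let e : ℤ × ℤ ≃ ℤ × ℤ :=
    { toFun := fun p => (p.1 - p.2, p.2)
      invFun := fun p => (p.1 + p.2, p.2)
      left_inv := fun p => by simp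
      right_inv := fun p => by simp }
  have hs := summable_mul_of_summable_norm hs1 hs2
  have hs' := e.summable_iff.mpr hs
  simp only [Function.comp_def] at hs'
  rw [← e.tsum_eq, Summable.tsum_prod hs', Th, ← tsum_mul_left]
  refine tsum_congr fun N => ?_
  have : ∀ n : ℤ, bb τ (N - n) * ee ((N - n : ℤ) * z) * (ee (n * z) * (DD τ u n)⁻¹)
      = ee (N * z) * (bb τ (N - n) * (DD τ u n)⁻¹) := by
    intro n
    have : ee (N * z) = ee ((N - n : ℤ) * z) * ee (n * z) := by
      rw [← ee_add]; congr 1; push_cast; ring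
    rw [this]; ring
  calc _ = ∑' n : ℤ, ee (N * z) * (bb τ (N - n) * (DD τ u n)⁻¹) := tsum_congr this
    _ = _ := by
      rw [tsum_mul_left]
      change ee (N * z) * ff τ u N = _
      rw [ff_eq hτ u hu, mul_add, ee_add]; ring

lemma ff_mul_Th {τ u : ℂ} (hτ : 0 < τ.im) (hu : ∀ n, DD τ u n ≠ 0) :
    ff τ u 0 * Th τ u = - ∑' k : ℤ, k * bb τ k := by
  obtain ⟨C, hC0, hC⟩ := rr_bound hτ u hu
  -- path z = i t
  let zt : ℝ → ℂ := fun t => t * I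
  have hzim : ∀ t, (zt t).im = t := fun t => by simp [zt]
  have hztc : Filter.Tendsto zt (nhdsWithin 0 (Set.Ioi 0)) (nhdsWithin 0 {0}ᶜ) := by
    rw [tendsto_nhdsWithin_iff]
    constructor
    · have : Continuous zt := by fun_prop
      have h := this.tendsto 0
      simp only [zt, ofReal_zero, zero_mul] at h
      exact h.mono_left nhdsWithin_le_nhds
    · filter_upwards [self_mem_nhdsWithin] with t ht
      simp only [Set.mem_compl_iff, Set.mem_singleton_iff]
      intro h0
      have := hzim t
      rw [h0] at this
      simp at this
      exact ht.ne this
  have hzt0 : Filter.Tendsto zt (nhdsWithin 0 (Set.Ioi 0)) (nhds 0) :=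
    hztc.mono_right nhdsWithin_le_nhds
  have hev : ∀ᶠ t in nhdsWithin (0 : ℝ) (Set.Ioi 0), 0 < t ∧ t < τ.im / 2 := by
    have : Set.Ioo 0 (τ.im / 2) ∈ nhdsWithin (0 : ℝ) (Set.Ioi 0) :=
      Ioo_mem_nhdsGT (by linarith)
    exact this
  -- the limit of the right-hand side
  have hR : Filter.Tendsto (fun t => ff τ u 0 * Th τ (u + zt t)) (nhdsWithin 0 (Set.Ioi 0))
      (nhds (ff τ u 0 * Th τ u)) := by
    have h := ((continuous_Th hτ).tendsto (u + 0)).comp (hzt0.const_add u)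
    rw [add_zero] at h
    exact h.const_mul _
  have hT0 : Filter.Tendsto (fun t => Th τ (zt t)) (nhdsWithin 0 (Set.Ioi 0)) (nhds 0) := by
    have h := ((continuous_Th hτ).tendsto 0).comp hzt0
    rwa [Th_zero] at h
  have hb : Filter.Tendsto (fun t => Th τ (zt t) * ∑' n : ℤ, ee (n * zt t) * rr τ u n)
      (nhdsWithin 0 (Set.Ioi 0)) (nhds 0) := by
    refine Filter.Tendsto.zero_mul_isBoundedUnder_le hT0 ?_
    refine Filter.isBoundedUnder_of_eventually_le
      (a := ∑' n : ℤ, C * Real.exp (-2 * Real.pi * (τ.im / 2) * |(n : ℝ)|)) ?_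
    filter_upwards [hev] with t ht
    refine tsum_of_norm_bounded ((summable_exp_abs (by linarith)).mul_left C).hasSum fun n => ?_
    exact rr_ee_bound u hC0 hC (by rw [hzim]; exact ht.1) (by rw [hzim]; linarith) n
  have hee : HasDerivAt ee (2 * Real.pi * I) 0 := by
    have := ((hasDerivAt_id (0 : ℂ)).const_mul (2 * Real.pi * I)).cexp
    simpa [ee] using! this
  have hq : Filter.Tendsto (fun t => Th τ (zt t) * (1 - ee (zt t))⁻¹)
      (nhdsWithin 0 (Set.Ioi 0)) (nhds (- ∑' k : ℤ, k * bb τ k)) := by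
    have h1 := (hasDerivAt_iff_tendsto_slope.mp (hasDerivAt_Th hτ)).comp hztc
    have h2 := (hasDerivAt_iff_tendsto_slope.mp hee).comp hztc
    have hpi : (2 * Real.pi * I : ℂ) ≠ 0 := by simp [Real.pi_ne_zero]
    have h3 := (h1.div h2 hpi).neg
    have : -(2 * Real.pi * I * (∑' k : ℤ, k * bb τ k) / (2 * Real.pi * I))
        = - ∑' k : ℤ, k * bb τ k := by field_simp
    rw [this] at h3
    refine h3.congr' ?_
    filter_upwards [self_mem_nhdsWithin] with t ht
    have hz0 : zt t ≠ 0 := by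
      intro h0
      have := hzim t
      rw [h0] at this
      simp at this
      exact (Set.mem_Ioi.mp ht).ne this
    simp only [Pi.div_apply, Function.comp, slope_def_field, Th_zero, ee_zero, sub_zero]
    rw [div_div_div_cancel_right₀ hz0, div_eq_mul_inv, ← neg_sub (ee (zt t)) 1, inv_neg]
    ring
  have hL := hb.add hq
  rw [zero_add] at hL
  refine tendsto_nhds_unique (hR.congr' ?_) hL
  filter_upwards [hev] with t ht
  have h1 : 0 < (zt t).im := by rw [hzim]; exact ht.1
  have h2 : (zt t).im < τ.im := by rw [hzim]; linarith
  rw [← Th_mul_SS hτ hu h1 h2, SS, tsum_congr (ee_div_DD τ u (zt t)),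
    Summable.tsum_add (summable_rr hτ hu h1 h2).of_norm (summable_pos_ee h1).of_norm,
    tsum_pos_ee h1]
  ring

/-! ### Jacobi's identity for the cube of the Euler product -/

/-- Gaussian binomial coefficients -/
noncomputable def GG (q : ℂ) : ℕ → ℕ → ℂ
  | _, 0 => 1
  | 0, _ + 1 => 0
  | n + 1, k + 1 => q ^ (k + 1) * GG q n (k + 1) + GG q n k

/-- finite Euler product -/
noncomputable def PP (q : ℂ) (n : ℕ) : ℂ := ∏ j ∈ Finset.range n, (1 - q ^ (j + 1))

lemma GG_zero (q : ℂ) (n : ℕ) : GG q n 0 = 1 := by cases n <;> rw [GG]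

lemma GG_of_lt (q : ℂ) (n k : ℕ) (h : n < k) : GG q n k = 0 := by
  induction n generalizing k with
  | zero =>
    obtain ⟨k, rfl⟩ : ∃ j, k = j + 1 := ⟨k - 1, by omega⟩
    rw [GG]
  | succ n ih =>
    obtain ⟨k, rfl⟩ : ∃ j, k = j + 1 := ⟨k - 1, by omega⟩
    rw [GG, ih _ (by omega), ih _ (by omega)]; ring

lemma GG_self (q : ℂ) (n : ℕ) : GG q n n = 1 := by
  induction n with
  | zero => rw [GG]
  | succ n ih => rw [GG, ih, GG_of_lt _ _ _ (by omega)]; ring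

lemma PP_succ (q : ℂ) (n : ℕ) : PP q (n + 1) = PP q n * (1 - q ^ (n + 1)) := by
  rw [PP, Finset.prod_range_succ, PP]

lemma PP_zero (q : ℂ) : PP q 0 = 1 := by simp [PP]

lemma GG_mul (q : ℂ) (n : ℕ) : ∀ a b : ℕ, a + b = n → GG q n a * PP q a * PP q b = PP q n := by
  induction n with
  | zero =>
    intro a b h
    obtain ⟨rfl, rfl⟩ : a = 0 ∧ b = 0 := by omega
    simp [GG_zero, PP_zero]
  | succ n ih =>
    intro a b h
    rcases a with _ | a
    · obtain rfl : b = n + 1 := by omega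
      simp [GG_zero, PP_zero]
    rcases b with _ | b
    · obtain rfl : a = n := by omega
      simp [GG_self, PP_zero]
    have h1 := ih (a + 1) b (by omega)
    have h2 := ih a (b + 1) (by omega)
    have hn : n = a + b + 1 := by omega
    have hp : q ^ (n + 1) = q ^ (a + 1) * q ^ (b + 1) := by rw [← pow_add]; congr 1; omega
    rw [GG, PP_succ q n, hp]
    have e1 : GG q n (a + 1) * PP q (a + 1) * PP q (b + 1) = PP q n * (1 - q ^ (b + 1)) := by
      rw [PP_succ q b, ← h1]; ring
    have e2 : GG q n a * PP q (a + 1) * PP q (b + 1) = PP q n * (1 - q ^ (a + 1)) := by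
      rw [PP_succ q a, ← h2]; ring
    linear_combination q ^ (a + 1) * e1 + e2

lemma rothe (q : ℂ) (n : ℕ) : ∀ y : ℂ, ∏ j ∈ Finset.range n, (1 + y * q ^ j)
    = ∑ k ∈ Finset.range (n + 1), q ^ (k.choose 2) * GG q n k * y ^ k := by
  induction n with
  | zero => intro y; simp [GG_zero]
  | succ n ih =>
    intro y
    rw [Finset.prod_range_succ']
    have h1 : ∀ j, 1 + y * q ^ (j + 1) = 1 + (y * q) * q ^ j := fun j => by ring
    simp_rw [h1]
    rw [ih, pow_zero, mul_one, mul_add, mul_one]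
    have h2 : ∑ k ∈ Finset.range (n + 1), q ^ (k.choose 2) * GG q n k * (y * q) ^ k
        = ∑ k ∈ Finset.range (n + 1), q ^ ((k + 1).choose 2) * q ^ (k + 1) *
          GG q n (k + 1) * y ^ (k + 1) + 1 := by
      have : ∑ k ∈ Finset.range (n + 1), q ^ (k.choose 2) * GG q n k * (y * q) ^ k
        = ∑ k ∈ Finset.range (n + 2), q ^ (k.choose 2) * GG q n k * (y * q) ^ k := by
        rw [Finset.sum_range_succ _ (n + 1), GG_of_lt q n (n + 1) (by omega)]; ring
      rw [this, Finset.sum_range_succ']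
      congr 1
      · refine Finset.sum_congr rfl fun k _ => ?_
        rw [mul_pow]; ring
      · simp [GG_zero]
    rw [Finset.sum_range_succ' _ (n + 1)]
    have h3 : q ^ (Nat.choose 0 2) * GG q (n + 1) 0 * y ^ 0 = 1 := by simp [GG_zero]
    rw [h3]
    have h4 : ∀ k ∈ Finset.range (n + 1),
        q ^ ((k + 1).choose 2) * GG q (n + 1) (k + 1) * y ^ (k + 1)
        = q ^ ((k + 1).choose 2) * q ^ (k + 1) * GG q n (k + 1) * y ^ (k + 1)
          + q ^ (k.choose 2) * GG q n k * (y * q) ^ k * y := by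
      intro k _
      have : (k + 1).choose 2 = k + k.choose 2 := by
        rw [Nat.choose_succ_succ' k 1, Nat.choose_one_right]
      rw [GG, mul_pow, this]; ring
    rw [Finset.sum_congr rfl h4, Finset.sum_add_distrib, ← Finset.sum_mul]
    rw [h2]; ring

lemma ch_succ (k : ℕ) : (k + 1).choose 2 = k + k.choose 2 := by
  rw [Nat.choose_succ_succ' k 1, Nat.choose_one_right]

lemma A_one (q : ℂ) (hq : q ≠ 0) (N : ℕ) :
    (∏ j ∈ Finset.range N, (1 - q ^ j / q ^ N)) * ((-1) ^ N * q ^ ((N + 1).choose 2)) = PP q N := by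
  induction N with
  | zero => simp [PP_zero]
  | succ N ih =>
    rw [Finset.prod_range_succ', ch_succ (N + 1)]
    have h1 : ∀ j, 1 - q ^ (j + 1) / q ^ (N + 1) = 1 - q ^ j / q ^ N := by
      intro j; rw [pow_succ, pow_succ, mul_div_mul_right _ _ hq]
    simp_rw [h1]
    rw [PP_succ, ← ih]
    field_simp
    ring

lemma finite_jacobi (q : ℂ) (hq : q ≠ 0) (M : ℕ) :
    ∑ k ∈ Finset.range (2 * (M + 1) + 1), ((M + 1 : ℕ) - k : ℂ) * GG q (2 * (M + 1)) k *
      (q ^ (k.choose 2) * (-1 / q ^ (M + 1)) ^ k * ((-1) ^ (M + 1) * q ^ ((M + 2).choose 2)))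
      = PP q (M + 1) * PP q M := by
  set N := M + 1 with hN
  let c : ℕ → ℂ := fun k => q ^ (k.choose 2) * GG q (2 * N) k * (-1 / q ^ N) ^ k
  let A : ℂ → ℂ := fun x => ∏ j ∈ Finset.range N, (1 - x * (q ^ j / q ^ N))
  let B : ℂ → ℂ := fun x => ∏ j ∈ Finset.range M, (1 - x * q ^ (j + 1))
  have hf : ∀ x, ∑ k ∈ Finset.range (2 * N + 1), c k * x ^ k = A x * B x * (1 - x) := by
    intro x
    have h := rothe q (2 * N) (-x / q ^ N)
    have h1 : ∑ k ∈ Finset.range (2 * N + 1), c k * x ^ k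
        = ∑ k ∈ Finset.range (2 * N + 1), q ^ (k.choose 2) * GG q (2 * N) k * (-x / q ^ N) ^ k := by
      refine Finset.sum_congr rfl fun k _ => ?_
      have : -x / q ^ N = (-1 / q ^ N) * x := by ring
      simp only [c]
      rw [this, mul_pow]; ring
    rw [h1, ← h, two_mul, Finset.prod_range_add]
    have h2 : ∏ j ∈ Finset.range N, (1 + -x / q ^ N * q ^ j) = A x :=
      Finset.prod_congr rfl fun j _ => by ring
    have h3 : ∏ j ∈ Finset.range N, (1 + -x / q ^ N * q ^ (N + j)) = B x * (1 - x) := by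
      have : ∀ j, 1 + -x / q ^ N * q ^ (N + j) = 1 - x * q ^ j := by
        intro j; rw [pow_add]; field_simp; ring
      simp_rw [this]
      rw [hN, Finset.prod_range_succ', pow_zero, mul_one]
    rw [h2, h3]; ring
  have hd1 : HasDerivAt (fun x => ∑ k ∈ Finset.range (2 * N + 1), c k * x ^ k)
      (∑ k ∈ Finset.range (2 * N + 1), c k * (k * 1 ^ (k - 1))) (1 : ℂ) :=
    HasDerivAt.fun_sum fun k _ => (hasDerivAt_pow k (1 : ℂ)).const_mul (c k)
  have hAB : DifferentiableAt ℂ (fun x => A x * B x) 1 := by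
    simp only [A, B]
    fun_prop
  have hd2 : HasDerivAt (fun x => A x * B x * (1 - x)) (-(A 1 * B 1)) (1 : ℂ) := by
    have := hAB.hasDerivAt.mul ((hasDerivAt_id (1 : ℂ)).const_sub 1)
    simpa using! this
  have heq := hd1.unique ((funext hf : (fun x => ∑ k ∈ Finset.range (2 * N + 1), c k * x ^ k) = _) ▸ hd2)
  have h0 := hf 1
  simp only [one_pow, mul_one, sub_self, mul_zero] at heq h0
  have hA := A_one q hq N
  have hA1 : A 1 = ∏ j ∈ Finset.range N, (1 - q ^ j / q ^ N) := by simp [A]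
  have hB1 : B 1 = PP q M := by simp [B, PP]
  rw [← hA, ← hA1, ← hB1]
  have : ∑ k ∈ Finset.range (2 * N + 1), ((N : ℕ) - k : ℂ) * GG q (2 * N) k *
      (q ^ (k.choose 2) * (-1 / q ^ N) ^ k * ((-1) ^ N * q ^ ((M + 2).choose 2)))
      = ((-1) ^ N * q ^ ((N + 1).choose 2)) * (N * ∑ k ∈ Finset.range (2 * N + 1), c k
        - ∑ k ∈ Finset.range (2 * N + 1), c k * k) := by
    rw [Finset.mul_sum, ← Finset.sum_sub_distrib, Finset.mul_sum]
    refine Finset.sum_congr rfl fun k _ => ?_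
    simp only [c, hN]; ring
  rw [this, h0, heq]; ring

lemma ee_nat_mul (τ : ℂ) (n : ℕ) : ee (n * τ) = ee τ ^ n := by
  rw [ee, ee, ← Complex.exp_nat_mul]; congr 1; ring

lemma bb_nat (τ : ℂ) (N : ℕ) : (-1) ^ N * ee τ ^ ((N + 1).choose 2) = bb τ N := by
  induction N with
  | zero => simp [bb, ee_zero]
  | succ N ih =>
    push_cast
    rw [bb_succ, ← ih, ch_succ (N + 1)]
    have := ee_nat_mul τ (N + 1)
    push_cast at this ⊢
    rw [this]; ring

lemma bb_sub (τ : ℂ) (N k : ℕ) : ee τ ^ (k.choose 2) * (-1 / ee τ ^ N) ^ k *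
    ((-1) ^ N * ee τ ^ ((N + 1).choose 2)) = bb τ (N - k) := by
  induction k with
  | zero => rw [bb_nat]; simp
  | succ k ih =>
    have h := bb_succ τ (N - k - 1)
    rw [sub_add_cancel, ← ih] at h
    have h2 : ((N - k - 1 : ℤ) : ℂ) + 1 = N - k := by push_cast; ring
    have h3 : ee ((N - k : ℂ) * τ) = ee τ ^ N / ee τ ^ k := by
      rw [sub_mul, sub_eq_add_neg, ee_add, ee_neg, ee_nat_mul, ee_nat_mul]; rfl
    rw [h2, h3] at h
    have h4 : ((N : ℤ) - (k + 1 : ℕ)) = N - k - 1 := by push_cast; ring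
    rw [h4, ch_succ]
    have hne := ee_ne_zero τ
    have hne2 : -(ee τ ^ N / ee τ ^ k) ≠ 0 := by
      rw [neg_ne_zero]; positivity
    apply mul_left_cancel₀ hne2
    rw [← h]
    have g1 : ee τ ^ N / ee τ ^ k * ee τ ^ k = ee τ ^ N := by field_simp
    have g2 : (-1 / ee τ ^ N) * ee τ ^ N = -1 := by field_simp
    rw [pow_add, pow_succ (-1 / ee τ ^ N)]
    generalize -1 / ee τ ^ N = a at *
    generalize ee τ ^ N / ee τ ^ k = c at *
    linear_combination (-(ee τ ^ (k.choose 2) * a ^ k * a *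
      ((-1) ^ N * ee τ ^ ((N + 1).choose 2)))) * g1 - (ee τ ^ (k.choose 2) * a ^ k *
      ((-1) ^ N * ee τ ^ ((N + 1).choose 2))) * g2

lemma norm_ee_lt_one {τ : ℂ} (hτ : 0 < τ.im) : ‖ee τ‖ < 1 := by
  rw [norm_ee, Real.exp_lt_one_iff]
  have := mul_pos Real.pi_pos hτ; nlinarith

lemma PP_ne_zero {q : ℂ} (hq : ‖q‖ < 1) (n : ℕ) : PP q n ≠ 0 := by
  rw [PP, Finset.prod_ne_zero_iff]
  intro j _ h
  have : q ^ (j + 1) = 1 := (sub_eq_zero.mp h).symm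
  have h2 : ‖q‖ ^ (j + 1) < 1 := pow_lt_one₀ (norm_nonneg _) hq (by omega)
  rw [← norm_pow, this, norm_one] at h2
  exact lt_irrefl _ h2

/-- infinite Euler product -/
noncomputable def PPinf (q : ℂ) : ℂ := ∏' n : ℕ, (1 - q ^ (n + 1))

lemma PP_tendsto {q : ℂ} (hq : ‖q‖ < 1) :
    Filter.Tendsto (PP q) Filter.atTop (nhds (PPinf q)) :=
  (ModularForm.multipliable_one_sub_pow hq).hasProd.tendsto_prod_nat

lemma PPinf_ne_zero {q : ℂ} (hq : ‖q‖ < 1) : PPinf q ≠ 0 := by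
  have := tprod_one_add_ne_zero_of_summable (f := fun n : ℕ => -q ^ (n + 1)) (by
    intro i h
    have h1 := PP_ne_zero hq (i + 1)
    rw [PP_succ] at h1
    apply right_ne_zero_of_mul h1
    linear_combination h) (by
      simpa using (summable_nat_add_iff 1).mpr (summable_geometric_of_lt_one (norm_nonneg _) hq))
  simpa [PPinf, sub_eq_add_neg] using this

/-- truncated coefficients -/
noncomputable def HH (q : ℂ) (N : ℕ) (s : ℤ) : ℂ :=
  if s ≤ N then GG q (2 * N) (N - s).toNat else 0

lemma HH_eq {q : ℂ} (hq : ‖q‖ < 1) (N : ℕ) (s : ℤ) (h1 : s ≤ N) (h2 : -N ≤ s) :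
    HH q N s = PP q (2 * N) * (PP q (N - s).toNat)⁻¹ * (PP q (N + s).toNat)⁻¹ := by
  rw [HH, if_pos h1, ← GG_mul q (2 * N) (N - s).toNat (N + s).toNat (by omega)]
  have := PP_ne_zero hq (N - s).toNat
  have := PP_ne_zero hq (N + s).toNat
  field_simp

lemma jacobi_cube {τ : ℂ} (hτ : 0 < τ.im) : ∑' k : ℤ, k * bb τ k = PPinf (ee τ) ^ 3 := by
  have hq := norm_ee_lt_one hτ
  set q := ee τ with hqdef
  have hq0 : q ≠ 0 := ee_ne_zero τ
  have hP := PP_tendsto hq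
  have hPI := PPinf_ne_zero hq
  have hPinv := hP.inv₀ hPI
  obtain ⟨C1, hC1⟩ := (Metric.isBounded_range_of_tendsto _ hP).exists_norm_le
  obtain ⟨C2, hC2⟩ := (Metric.isBounded_range_of_tendsto _ hPinv).exists_norm_le
  have hC1' : ∀ n, ‖PP q n‖ ≤ C1 := fun n => hC1 _ ⟨n, rfl⟩
  have hC2' : ∀ n, ‖(PP q n)⁻¹‖ ≤ C2 := fun n => hC2 _ ⟨n, rfl⟩
  have hC1n : 0 ≤ C1 := (norm_nonneg _).trans (hC1' 0)
  have hC2n : 0 ≤ C2 := (norm_nonneg _).trans (hC2' 0)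
  have hHb : ∀ N s, ‖HH q N s‖ ≤ C1 * C2 * C2 := by
    intro N s
    by_cases h1 : s ≤ N
    · by_cases h2 : -N ≤ s
      · rw [HH_eq hq N s h1 h2, norm_mul, norm_mul]
        gcongr
        · exact hC1' _
        · exact hC2' _
        · exact hC2' _
      · rw [HH, if_pos h1, GG_of_lt _ _ _ (by omega), norm_zero]; positivity
    · rw [HH, if_neg h1, norm_zero]; positivity
  have hsum : Summable fun s : ℤ => ‖(s : ℂ) * bb τ s‖ := by
    have h := ((summable_jacobiTheta₂'_term_iff (0 + (1 / 2 + τ / 2)) τ).mpr hτ).norm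
    have hpi : (2 * Real.pi * I : ℂ) ≠ 0 := by simp [Real.pi_ne_zero]
    refine (h.mul_left ‖(2 * Real.pi * I : ℂ)‖⁻¹).congr fun s => ?_
    rw [jacobiTheta₂'_term, ← bb_mul_ee, mul_zero, ee_zero, mul_one, mul_assoc _ (s : ℂ),
      norm_mul _ ((s : ℂ) * _), inv_mul_cancel_left₀ (norm_ne_zero_iff.mpr hpi)]
  have htoNat : ∀ s : ℤ, Filter.Tendsto (fun N : ℕ => ((N : ℤ) + s).toNat)
      Filter.atTop Filter.atTop := by
    intro s
    rw [Filter.tendsto_atTop]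
    intro b
    filter_upwards [Filter.eventually_ge_atTop (b + s.natAbs)] with N hN
    omega
  have hlim : Filter.Tendsto (fun N : ℕ => ∑' s : ℤ, (s : ℂ) * bb τ s * HH q N s) Filter.atTop
      (nhds (∑' s : ℤ, (s : ℂ) * bb τ s * (PPinf q * (PPinf q)⁻¹ * (PPinf q)⁻¹))) := by
    refine tendsto_tsum_of_dominated_convergence (bound := fun s : ℤ =>
      ‖(s : ℂ) * bb τ s‖ * (C1 * C2 * C2)) (hsum.mul_right _) ?_ ?_
    · intro s
      refine Filter.Tendsto.const_mul _ ?_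
      have h1 : Filter.Tendsto (fun N : ℕ => 2 * N) Filter.atTop Filter.atTop :=
        Filter.tendsto_id.const_mul_atTop' (by norm_num)
      have h2 := ((hP.comp h1).mul (hPinv.comp (htoNat (-s)))).mul (hPinv.comp (htoNat s))
      refine h2.congr' ?_
      filter_upwards [Filter.eventually_ge_atTop s.natAbs] with N hN
      rw [HH_eq hq N s (by omega) (by omega)]
      rfl
    · filter_upwards with N s
      rw [norm_mul]
      gcongr
      exact hHb N s
  have hfin : ∀ M : ℕ, ∑' s : ℤ, (s : ℂ) * bb τ s * HH q (M + 1) s = PP q (M + 1) * PP q M := by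
    intro M
    rw [← finite_jacobi q hq0 M]
    have hinj : Function.Injective (fun k : ℕ => ((M + 1 : ℕ) : ℤ) - k) := by
      intro a b h
      simp only at h
      omega
    rw [← hinj.tsum_eq]
    · rw [tsum_eq_sum (s := Finset.range (2 * (M + 1) + 1))]
      · refine Finset.sum_congr rfl fun k _ => ?_
        rw [bb_sub τ (M + 1) k, HH, if_pos (by omega)]
        have : (((M + 1 : ℕ) : ℤ) - (((M + 1 : ℕ) : ℤ) - k)).toNat = k := by omega
        rw [this]; push_cast; ring
      · intro k hk
        rw [Finset.mem_range, not_lt] at hk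
        rw [HH, if_pos (by omega)]
        have : (((M + 1 : ℕ) : ℤ) - (((M + 1 : ℕ) : ℤ) - k)).toNat = k := by omega
        rw [this, GG_of_lt _ _ _ (by omega), mul_zero]
    · intro s hs
      have h1 : s ≤ (M + 1 : ℕ) := by
        by_contra hc
        apply hs
        simp only
        rw [HH, if_neg hc, mul_zero]
      exact ⟨((M + 1 : ℕ) - s).toNat, by simp only; omega⟩
  have hlim2 := (hlim.comp (Filter.tendsto_add_atTop_nat 1)).congr
    (f₂ := fun M => PP q (M + 1) * PP q M) (fun M => hfin M)
  have hlim3 := (hP.comp (Filter.tendsto_add_atTop_nat 1)).mul hP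
  have h := tendsto_nhds_unique hlim2 hlim3
  rw [tsum_mul_right] at h
  field_simp at h
  rw [h]
  try ring

lemma eta_eq (τ : ℂ) : dedekindEta τ ^ 3 = ee (τ / 8) * PPinf (ee τ) ^ 3 := by
  rw [dedekindEta, mul_pow]
  congr 1
  · rw [← Complex.exp_nat_mul, ee]; congr 1; push_cast; ring
  · congr 1
    refine tprod_congr fun n => ?_
    have := ee_nat_mul τ (n + 1)
    rw [← this, ee]; congr 2; push_cast; ring

lemma kronecker {τ u z : ℂ} (hτ : 0 < τ.im) (hu : ∀ n, DD τ u n ≠ 0)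
    (hz : 0 < z.im) (hz' : z.im < τ.im) (h1 : jacobiTheta1 u τ ≠ 0) (h2 : jacobiTheta1 z τ ≠ 0) :
    ∑' n : ℤ, ee (n * z) * (DD τ u n)⁻¹ = dedekindEta τ ^ 3 * jacobiTheta1 (u + z) τ /
            (I * jacobiTheta1 u τ * jacobiTheta1 z τ) := by
  have e1 := Th_mul_SS hτ hu hz hz'
  have e2 := ff_mul_Th hτ hu
  rw [jacobi_cube hτ] at e2
  rw [theta1_eq] at h1 h2
  have h1' := right_ne_zero_of_mul h1
  have h2' := right_ne_zero_of_mul h2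
  change SS τ u z = _
  rw [eta_eq, theta1_eq, theta1_eq, theta1_eq, add_div, ee_add]
  have hI : I ^ 2 = -1 := Complex.I_sq
  have n1 := ee_ne_zero (τ / 8)
  have n2 := ee_ne_zero (u / 2)
  have n3 := ee_ne_zero (z / 2)
  have nI := Complex.I_ne_zero
  rw [eq_div_iff (by positivity)]
  have e3 : SS τ u z * (Th τ u * Th τ z) = - PPinf (ee τ) ^ 3 * Th τ (u + z) := by
    rw [← e2]; linear_combination Th τ u * e1
  have hI3 : I ^ 3 = -I := by rw [pow_succ, hI]; ring
  linear_combination (I ^ 3 * ee (τ / 8) ^ 2 * ee (u / 2) * ee (z / 2)) * e3 -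
    (ee (τ / 8) ^ 2 * ee (u / 2) * ee (z / 2) * PPinf (ee τ) ^ 3 * Th τ (u + z)) * hI3

/-! ### Lattice sums -/

lemma pi_sum {n : ℕ} : ∀ (f : Fin n → ℤ → ℂ), (∀ j, Summable fun k => ‖f j k‖) →
    (Summable fun l : Fin n → ℤ => ‖∏ j, f j (l j)‖) ∧
      ∑' l : Fin n → ℤ, ∏ j, f j (l j) = ∏ j, ∑' k, f j k := by
  induction n with
  | zero =>
    intro f _
    constructor
    · exact (hasSum_fintype _).summable
    · simp [tsum_fintype]
  | succ n ih =>
    intro f hf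
    obtain ⟨h1, h2⟩ := ih (fun j => f j.succ) (fun j => hf j.succ)
    let e : ℤ × (Fin n → ℤ) ≃ (Fin (n + 1) → ℤ) := Fin.consEquiv (fun _ => ℤ)
    have he : ∀ p, ∏ j, f j (e p j) = f 0 p.1 * ∏ j : Fin n, f j.succ (p.2 j) := by
      intro p
      rw [Fin.prod_univ_succ]
      simp [e, Fin.consEquiv]
    constructor
    · rw [← e.summable_iff]
      refine ((hf 0).mul_norm h1).congr fun p => ?_
      rw [Function.comp, he]
    · rw [← e.tsum_eq, tsum_congr he, Fin.prod_univ_succ, ← h2,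
        tsum_mul_tsum_of_summable_norm (hf 0) h1]

lemma posdef_bound {n : ℕ} (A : Matrix (Fin n) (Fin n) ℝ) (hA : A.PosDef) :
    ∃ δ : ℝ, 0 < δ ∧ ∀ x : Fin n → ℝ, δ * ∑ i, x i ^ 2 ≤ ∑ i, ∑ j, x i * A i j * x j := by
  have hform : ∀ x : Fin n → ℝ, ∑ i, ∑ j, x i * A i j * x j = x ⬝ᵥ A.mulVec x := by
    intro x
    simp only [dotProduct, Matrix.mulVec, Finset.mul_sum]
    exact Finset.sum_congr rfl fun i _ => Finset.sum_congr rfl fun j _ => by ring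
  have hpos : ∀ x : Fin n → ℝ, x ≠ 0 → 0 < ∑ i, ∑ j, x i * A i j * x j := by
    intro x hx
    rw [hform]
    simpa using hA.dotProduct_mulVec_pos hx
  let F : (Fin n → ℝ) → ℝ := fun x => ∑ i, ∑ j, x i * A i j * x j
  have hF : Continuous F := by simp only [F]; fun_prop
  have hS : IsCompact {x : Fin n → ℝ | ∑ i, x i ^ 2 = 1} := by
    refine Metric.isCompact_of_isClosed_isBounded ?_ ?_
    · exact isClosed_eq (by fun_prop) continuous_const
    · refine (Metric.isBounded_closedBall (x := (0 : Fin n → ℝ)) (r := 1)).subset ?_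
      intro x hx
      rw [mem_closedBall_zero_iff, pi_norm_le_iff_of_nonneg zero_le_one]
      intro i
      rw [Real.norm_eq_abs, ← sq_le_one_iff_abs_le_one]
      have hx' : ∑ i, x i ^ 2 = 1 := hx
      rw [← hx']
      exact Finset.single_le_sum (f := fun i => x i ^ 2) (fun i _ => sq_nonneg _) (Finset.mem_univ i)
  have key : ∃ δ : ℝ, 0 < δ ∧ ∀ x ∈ {x : Fin n → ℝ | ∑ i, x i ^ 2 = 1}, δ ≤ F x := by
    rcases Set.eq_empty_or_nonempty {x : Fin n → ℝ | ∑ i, x i ^ 2 = 1} with h | h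
    · exact ⟨1, one_pos, by rw [h]; simp⟩
    · obtain ⟨x0, hx0, hmin⟩ := hS.exists_isMinOn h hF.continuousOn
      refine ⟨F x0, hpos x0 ?_, fun x hx => hmin hx⟩
      rintro rfl
      simp at hx0
  obtain ⟨δ, hδ, hb⟩ := key
  refine ⟨δ, hδ, fun x => ?_⟩
  by_cases hx : x = 0
  · subst hx; simp
  have hs : 0 < ∑ i, x i ^ 2 := by
    obtain ⟨i, hi⟩ := Function.ne_iff.mp hx
    exact Finset.sum_pos' (fun i _ => sq_nonneg _) ⟨i, Finset.mem_univ i, by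
      have : x i ≠ 0 := hi
      positivity⟩
  set s := ∑ i, x i ^ 2 with hsdef
  set r := Real.sqrt s with hr
  have hr2 : r ^ 2 = s := Real.sq_sqrt hs.le
  have hrpos : 0 < r := Real.sqrt_pos.mpr hs
  have h1 := hb (fun i => x i / r) (by
    simp only [Set.mem_setOf_eq, div_pow]
    rw [← Finset.sum_div, hr2, ← hsdef, div_self hs.ne'])
  have h2 : F (fun i => x i / r) = F x / s := by
    simp only [F]
    rw [Finset.sum_div]
    refine Finset.sum_congr rfl fun i _ => ?_
    rw [Finset.sum_div]
    refine Finset.sum_congr rfl fun j _ => ?_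
    rw [← hr2]; field_simp
  rw [h2, le_div_iff₀ hs] at h1
  exact h1

/-- theta summand -/
noncomputable def thT (np : ℕ) (Q : Matrix (Fin np) (Fin np) ℤ) (R : ℚ)
    (v : Fin np → ℂ) (τ : ℂ) (k : Fin np → ℤ) : ℂ :=
    Complex.exp (Real.pi * I * τ * (((∑ i, ∑ j, k i * Q i j * k j : ℤ) : ℂ) + 2 * (R : ℂ))) *
      Complex.exp (2 * Real.pi * I * ∑ i, v i * (k i : ℂ))

lemma summable_theta (np : ℕ)
    (Q : Matrix (Fin np) (Fin np) ℤ) (hQpos : (Q.map ((↑) : ℤ → ℝ)).PosDef)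
    (R : ℚ) (τ : ℂ) (hτ : 0 < τ.im) (v : Fin np → ℂ) :
    Summable fun k => ‖thT np Q R v τ k‖ := by
  obtain ⟨δ, hδ, hb⟩ := posdef_bound _ hQpos
  let τ' : ℂ := (δ * τ.im : ℝ) * I
  have hτ' : τ'.im = δ * τ.im := by simp [τ']
  have h1 := (pi_sum (fun (i : Fin np) k => jacobiTheta₂_term k (v i) τ') (fun i =>
    ((summable_jacobiTheta₂_term_iff (v i) τ').mpr (by rw [hτ']; positivity)).norm)).1
  refine (h1.mul_left (Real.exp (-2 * Real.pi * τ.im * R))).of_nonneg_of_le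
    (fun _ => norm_nonneg _) fun k => ?_
  rw [norm_prod]
  simp_rw [norm_jacobiTheta₂_term]
  rw [← Real.exp_sum, ← Real.exp_add, thT, norm_mul, Complex.norm_exp, Complex.norm_exp,
    ← Real.exp_add, Real.exp_le_exp]
  set S : ℤ := ∑ i, ∑ j, k i * Q i j * k j with hS
  have hq : δ * ∑ i, (k i : ℝ) ^ 2 ≤ (S : ℝ) := by
    have := hb (fun i => (k i : ℝ))
    simp only [Matrix.map_apply] at this
    rw [hS]; push_cast; exact this
  have e1 : (Real.pi * I * τ * ((S : ℂ) + 2 * (R : ℂ))).re = -Real.pi * τ.im * (S + 2 * R) := by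
    have : Real.pi * I * τ * ((S : ℂ) + 2 * (R : ℂ))
      = ((Real.pi * (S + 2 * R) : ℝ) : ℂ) * τ * I := by push_cast; ring
    rw [this, Complex.mul_I_re, Complex.im_ofReal_mul]; ring
  have e2 : (2 * Real.pi * I * ∑ i, v i * (k i : ℂ)).re = ∑ i, -(2 * Real.pi * k i * (v i).im) := by
    rw [Finset.mul_sum, Complex.re_sum]
    refine Finset.sum_congr rfl fun i _ => ?_
    have : 2 * Real.pi * I * (v i * (k i : ℂ)) = ((2 * Real.pi * k i : ℝ) : ℂ) * v i * I := by
      push_cast; ring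
    rw [this, Complex.mul_I_re, Complex.im_ofReal_mul]
  rw [e1, e2, hτ']
  simp_rw [sub_eq_add_neg]
  rw [Finset.sum_add_distrib]
  have e3 : ∑ i, -Real.pi * (k i : ℝ) ^ 2 * (δ * τ.im)
      = -(Real.pi * τ.im) * (δ * ∑ i, (k i : ℝ) ^ 2) := by
    rw [Finset.mul_sum, Finset.mul_sum]
    exact Finset.sum_congr rfl fun i _ => by ring
  rw [e3]
  have := mul_le_mul_of_nonneg_left hq (mul_pos Real.pi_pos hτ).le
  nlinarith

lemma appell_term_eq (np nm : ℕ) (Q : Matrix (Fin np) (Fin np) ℤ) (R : ℚ)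
    (m : Fin nm → Fin np → ℤ) (u : Fin nm → ℂ) (v : Fin np → ℂ) (z : Fin nm → ℂ) (τ : ℂ)
    (l : Fin nm → ℤ) (k : Fin np → ℤ) :
    genAppellTerm np nm Q R m (fun j => u j + (l j : ℂ) * τ) v τ k * ee (∑ j, (l j : ℂ) * z j)
    = thT np Q R (fun i => v i - ∑ j, (m j i : ℂ) * z j) τ k *
      ∏ j, (ee ((l j + ∑ i, m j i * k i : ℤ) * z j) * (DD τ (u j) (l j + ∑ i, m j i * k i))⁻¹) := by
  have hD : ∀ j, 1 - Complex.exp (2 * Real.pi * I * τ * (∑ i, (m j i : ℂ) * (k i : ℂ))) *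
        Complex.exp (2 * Real.pi * I * (u j + (l j : ℂ) * τ))
        = DD τ (u j) (l j + ∑ i, m j i * k i) := by
    intro j
    rw [DD, ee, ← Complex.exp_add]; congr 2; push_cast; ring
  simp only [genAppellTerm, hD, thT]
  rw [Finset.prod_mul_distrib, Finset.prod_inv_distrib, ← ee_sum]
  change _ * ee _ / _ * _ = _ * ee _ * _
  have hE : ee (∑ i, v i * (k i : ℂ)) * ee (∑ j, (l j : ℂ) * z j)
      = ee (∑ i, (v i - ∑ j, (m j i : ℂ) * z j) * (k i : ℂ)) *
        ee (∑ j, ((l j + ∑ i, m j i * k i : ℤ) : ℂ) * z j) := by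
    rw [← ee_add, ← ee_add]
    congr 1
    push_cast
    simp only [sub_mul, add_mul, Finset.sum_sub_distrib, Finset.sum_add_distrib, Finset.sum_mul]
    rw [Finset.sum_comm (f := fun i j => (m j i : ℂ) * z j * (k i : ℂ))]
    have : ∑ j, ∑ i, (m j i : ℂ) * z j * (k i : ℂ) = ∑ j, ∑ i, (m j i : ℂ) * (k i : ℂ) * z j :=
      Finset.sum_congr rfl fun j _ => Finset.sum_congr rfl fun i _ => by ring
    rw [this]; ring
  rw [div_mul_eq_mul_div, mul_assoc, hE, div_eq_mul_inv]
  ring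

theorem genAppell_theta_decomposition (np nm : ℕ)
    (Q : Matrix (Fin np) (Fin np) ℤ) (hQsymm : Q.IsSymm)
    (hQpos : (Q.map ((↑) : ℤ → ℝ)).PosDef)
    (R : ℚ) (m : Fin nm → Fin np → ℤ) (m0 : Fin nm → ℚ)
    (τ : ℂ) (hτ : 0 < τ.im) (u : Fin nm → ℂ) (v : Fin np → ℂ) (z : Fin nm → ℂ)
    (hz : ∀ j, 0 < (z j).im ∧ (z j).im < τ.im)
    (hden : ∀ (j : Fin nm) (k : Fin np → ℤ) (l : Fin nm → ℤ),
      1 - Complex.exp (2 * Real.pi * I * τ * (∑ i, (m j i : ℂ) * (k i : ℂ))) *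
        Complex.exp (2 * Real.pi * I * (u j + (l j : ℂ) * τ)) ≠ 0)
    (hθu : ∀ j, jacobiTheta1 (u j) τ ≠ 0) (hθz : ∀ j, jacobiTheta1 (z j) τ ≠ 0)
    (hsum : Summable (fun p : (Fin nm → ℤ) × (Fin np → ℤ) =>
      ‖genAppellTerm np nm Q R m (fun j => u j + (p.1 j : ℂ) * τ) v τ p.2 *
        Complex.exp (2 * Real.pi * I * ∑ j, (p.1 j : ℂ) * (z j - (m0 j : ℂ) * τ))‖)) :
    ∑' l : Fin nm → ℤ,
        genAppell np nm Q R m m0 (fun j => u j + (l j : ℂ) * τ) v τ *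
          Complex.exp (2 * Real.pi * I * (∑ j, (l j : ℂ) * (z j - (m0 j : ℂ) * τ))
            - 2 * Real.pi * I * ∑ j, (m0 j : ℂ) * u j)
      = genTheta np Q R (fun i => v i - ∑ j, (m j i : ℂ) * z j) τ *
          ∏ j, dedekindEta τ ^ 3 * jacobiTheta1 (u j + z j) τ /
            (I * jacobiTheta1 (u j) τ * jacobiTheta1 (z j) τ) := by
  have hu : ∀ j n, DD τ (u j) n ≠ 0 := by
    intro j n
    have h := hden j 0 (fun _ => n)
    simpa [DD, ee] using h
  let F : Fin nm → ℤ → ℂ := fun j n => ee (n * z j) * (DD τ (u j) n)⁻¹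
  let v' : Fin np → ℂ := fun i => v i - ∑ j, (m j i : ℂ) * z j
  obtain ⟨hF1, hF2⟩ := pi_sum F (fun j => summable_kron hτ (hu j) (hz j).1 (hz j).2)
  have hth := summable_theta np Q hQpos R τ hτ v'
  have hG := summable_mul_of_summable_norm hF1 hth
  let e : (Fin nm → ℤ) × (Fin np → ℤ) ≃ (Fin nm → ℤ) × (Fin np → ℤ) :=
    { toFun := fun p => (fun j => p.1 j + ∑ i, m j i * p.2 i, p.2)
      invFun := fun p => (fun j => p.1 j - ∑ i, m j i * p.2 i, p.2)
      left_inv := fun p => by simp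
      right_inv := fun p => by simp }
  have hterm : ∀ (l : Fin nm → ℤ) (k : Fin np → ℤ),
      genAppellTerm np nm Q R m (fun j => u j + (l j : ℂ) * τ) v τ k * ee (∑ j, (l j : ℂ) * z j)
      = (∏ j, F j ((e (l, k)).1 j)) * thT np Q R v' τ (e (l, k)).2 := by
    intro l k
    rw [appell_term_eq, mul_comm]
    rfl
  have hG' := e.summable_iff.mpr hG
  simp only [Function.comp_def] at hG'
  have hL : ∀ l : Fin nm → ℤ,
      genAppell np nm Q R m m0 (fun j => u j + (l j : ℂ) * τ) v τ *
          Complex.exp (2 * Real.pi * I * (∑ j, (l j : ℂ) * (z j - (m0 j : ℂ) * τ))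
            - 2 * Real.pi * I * ∑ j, (m0 j : ℂ) * u j)
      = ∑' k, (∏ j, F j ((e (l, k)).1 j)) * thT np Q R v' τ (e (l, k)).2 := by
    intro l
    have hE : Complex.exp (2 * Real.pi * I * ∑ j, (m0 j : ℂ) * (u j + (l j : ℂ) * τ)) *
        Complex.exp (2 * Real.pi * I * (∑ j, (l j : ℂ) * (z j - (m0 j : ℂ) * τ))
            - 2 * Real.pi * I * ∑ j, (m0 j : ℂ) * u j) = ee (∑ j, (l j : ℂ) * z j) := by
      rw [← Complex.exp_add, ee, ← mul_sub, ← mul_add, ← Finset.sum_sub_distrib,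
        ← Finset.sum_add_distrib]
      congr 2
      exact Finset.sum_congr rfl fun j _ => by ring
    rw [genAppell, mul_right_comm, hE, mul_comm, ← tsum_mul_right]
    exact tsum_congr fun k => hterm l k
  rw [tsum_congr hL, ← Summable.tsum_prod hG',
    e.tsum_eq (fun p => (∏ j, F j (p.1 j)) * thT np Q R v' τ p.2),
    ← tsum_mul_tsum_of_summable_norm hF1 hth, hF2, mul_comm]
  congr 1
  refine Finset.prod_congr rfl fun j _ => ?_
  exact kronecker hτ (hu j) (hz j).1 (hz j).2 (hθu j) (hθz j)
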